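/- Assume $2\alpha_2 \notin \mathbb{Z}$ and $2(\alpha_1+\alpha_2) \notin \mathbb{Z}$ (so all denominators below are nonzero). Then $\sum_{s=0}^{\ell-1}\sum_{t=0}^{\ell-1} \dfrac{\{\alpha_1+s\}}{\{\alpha_2+t\}\{\alpha_1+\alpha_2+s+t\}}\,\xi^{-2(t^2+st)} = \dfrac{\ell\,\{\alpha_1\}}{\{\alpha_2\}\{\alpha_1+\alpha_2\}}$. (This identity is exactly the statement $\Delta_+ = 1$ for the Kirby color $\Omega_{\overline{\mu}}$ in the relative $G$-modular category $\mathscr{C}^H$ of nilpotent weight $\mathcal{U}_{\xi}^{H}\mathfrak{sl}(2|1)$-modules.) -/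

import Mathlib

open Complex

/-- `ξ^x = exp(2πix/ℓ)`. -/
noncomputable def xi (ℓ : ℕ) (x : ℂ) : ℂ := Complex.exp (2 * (Real.pi : ℂ) * Complex.I * x / (ℓ : ℂ))

/-- `{x} = ξ^x - ξ^{-x}`. -/
noncomputable def br (ℓ : ℕ) (x : ℂ) : ℂ := xi ℓ x - xi ℓ (-x)

theorem xi_add (ℓ : ℕ) (x y : ℂ) : xi ℓ (x + y) = xi ℓ x * xi ℓ y := by
  simp only [xi, ← Complex.exp_add]
  congr 1
  ring

theorem xi_ne_zero (ℓ : ℕ) (x : ℂ) : xi ℓ x ≠ 0 := Complex.exp_ne_zero _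

theorem xi_mul_natCast (ℓ : ℕ) (x : ℂ) (n : ℕ) : xi ℓ (x * n) = xi ℓ x ^ n := by
  simp only [xi, ← Complex.exp_nat_mul]
  congr 1
  ring

theorem xi_neg (ℓ : ℕ) (x : ℂ) : xi ℓ (-x) = (xi ℓ x)⁻¹ := by
  simp only [xi, ← Complex.exp_neg]
  congr 1
  ring

theorem xi_two_mul_ne_one {ℓ : ℕ} (hℓ : ℓ ≠ 0) {x : ℂ} (hx : ∀ m : ℤ, 2 * x ≠ m) (n : ℕ) :
    xi ℓ (2 * (x + n)) ≠ 1 := by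
  intro h
  obtain ⟨k, hk⟩ := Complex.exp_eq_one_iff.mp h
  have hℓ' : (ℓ : ℂ) ≠ 0 := Nat.cast_ne_zero.mpr hℓ
  rw [div_eq_iff hℓ'] at hk
  have hk' : 2 * (x + n) = k * ℓ := by
    apply mul_left_cancel₀ Complex.two_pi_I_ne_zero
    linear_combination hk
  apply hx (k * ℓ - 2 * n)
  push_cast
  linear_combination hk'

/-- Partial fractions: `{y - x} / ({x} {y}) = 1 / (ξ^{2x} - 1) - 1 / (ξ^{2y} - 1)`. -/
theorem br_sub_div (ℓ : ℕ) {x y : ℂ} (hx : xi ℓ (2 * x) ≠ 1) (hy : xi ℓ (2 * y) ≠ 1) :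
    br ℓ (y - x) / (br ℓ x * br ℓ y) = (xi ℓ (2 * x) - 1)⁻¹ - (xi ℓ (2 * y) - 1)⁻¹ := by
  simp only [br, two_mul, sub_eq_add_neg y x, neg_add, xi_add, xi_neg, inv_inv] at hx hy ⊢
  have hx0 := xi_ne_zero ℓ x
  have hy0 := xi_ne_zero ℓ y
  generalize xi ℓ x = X at *
  generalize xi ℓ y = Y at *
  have hx1 : X * X - 1 ≠ 0 := sub_ne_zero.mpr hx
  have hy1 : Y * Y - 1 ≠ 0 := sub_ne_zero.mpr hy
  have ex : X - X⁻¹ = (X * X - 1) / X := by field_simp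
  have ey : Y - Y⁻¹ = (Y * Y - 1) / Y := by field_simp
  rw [ex, ey, inv_sub_inv hx1 hy1]
  field_simp
  ring

theorem isPrimitiveRoot_xi_neg_two {ℓ : ℕ} (hℓ : Odd ℓ) : IsPrimitiveRoot (xi ℓ (-2)) ℓ := by
  have h : xi ℓ (-2) = (Complex.exp (2 * Real.pi * Complex.I / ℓ) ^ 2)⁻¹ := by
    rw [xi, ← Complex.exp_nat_mul, ← Complex.exp_neg]
    congr 1
    push_cast
    ring
  rw [h]
  exact ((Complex.isPrimitiveRoot_exp ℓ hℓ.pos.ne').pow_of_coprime 2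
    (Nat.coprime_two_left.mpr hℓ)).inv

theorem IsPrimitiveRoot.sum_range_pow_mul {K : Type*} [Field K] {ω : K} {n : ℕ}
    (hω : IsPrimitiveRoot ω n) {t : ℕ} (ht : t < n) :
    ∑ s ∈ Finset.range n, ω ^ (t * s) = if t = 0 then (n : K) else 0 := by
  split_ifs with h
  · simp [h]
  · simp only [pow_mul]
    rw [geom_sum_eq (hω.pow_ne_one_of_pos_of_lt h ht), ← pow_mul, mul_comm, pow_mul, hω.pow_eq_one]
    simp

theorem Function.Periodic.sum_range_add {M : Type*} [AddCommGroup M] {f : ℕ → M} {n : ℕ}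
    (hf : Function.Periodic f n) (t : ℕ) :
    ∑ s ∈ Finset.range n, f (s + t) = ∑ s ∈ Finset.range n, f s := by
  induction t with
  | zero => rfl
  | succ t ih =>
    rw [← ih]
    have h := Finset.sum_range_succ' (fun s => f (s + t)) n
    have ht : f (n + t) = f t := by rw [add_comm, hf]
    rw [Finset.sum_range_succ, ht, zero_add] at h
    rw [add_right_cancel h]
    simp only [add_right_comm, add_assoc]

theorem IsPrimitiveRoot.sum_sum_sub_mul_pow {K : Type*} [Field K] {ω : K} {n : ℕ} (hn : 0 < n)
    (hω : IsPrimitiveRoot ω n) (f g : ℕ → K) (hg : Function.Periodic g n) :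
    ∑ s ∈ Finset.range n, ∑ t ∈ Finset.range n, (f t - g (s + t)) * ω ^ (t * (s + t)) =
      n * (f 0 - g 0) := by
  have h0 : 0 ∈ Finset.range n := Finset.mem_range.mpr hn
  have shift (h : ℕ → K) (hh : Function.Periodic h n) (t : ℕ) :
      ∑ s ∈ Finset.range n, h (s + t) * ω ^ (t * (s + t)) =
        ∑ s ∈ Finset.range n, h s * ω ^ (t * s) := by
    refine Function.Periodic.sum_range_add (f := fun u => h u * ω ^ (t * u)) (fun u => ?_) t
    simp only [hh u, mul_add, pow_add, mul_comm t n, pow_mul ω n, hω.pow_eq_one, one_pow, mul_one]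
  have hf : ∑ t ∈ Finset.range n, ∑ s ∈ Finset.range n, f t * ω ^ (t * (s + t)) = n * f 0 := by
    have (t : ℕ) (ht : t ∈ Finset.range n) :
        ∑ s ∈ Finset.range n, f t * ω ^ (t * (s + t)) = if t = 0 then n * f 0 else 0 := by
      rw [shift (fun _ => f t) (fun _ => rfl), ← Finset.mul_sum,
        hω.sum_range_pow_mul (Finset.mem_range.mp ht)]
      split_ifs with h <;> simp [h, mul_comm]
    rw [Finset.sum_congr rfl this, Finset.sum_ite_eq' _ 0 fun _ => n * f 0, if_pos h0]
  have hg' : ∑ t ∈ Finset.range n, ∑ s ∈ Finset.range n, g (s + t) * ω ^ (t * (s + t)) =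
      n * g 0 := by
    simp only [shift g hg]
    rw [Finset.sum_comm]
    have (s : ℕ) (hs : s ∈ Finset.range n) :
        ∑ t ∈ Finset.range n, g s * ω ^ (t * s) = if s = 0 then n * g 0 else 0 := by
      simp only [mul_comm _ s]
      rw [← Finset.mul_sum, hω.sum_range_pow_mul (Finset.mem_range.mp hs)]
      split_ifs with h <;> simp [h, mul_comm]
    rw [Finset.sum_congr rfl this, Finset.sum_ite_eq' _ 0 fun _ => n * g 0, if_pos h0]
  rw [Finset.sum_comm]
  simp only [sub_mul, Finset.sum_sub_distrib]
  rw [hf, hg', mul_sub]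

theorem xi_two_mul_add_periodic {ℓ : ℕ} (hℓ : ℓ ≠ 0) (x : ℂ) :
    Function.Periodic (fun n : ℕ => xi ℓ (2 * (x + n))) ℓ := by
  intro n
  have h : xi ℓ (2 * ℓ) = 1 := by
    rw [xi_mul_natCast, xi, ← Complex.exp_nat_mul, Complex.exp_eq_one_iff]
    refine ⟨2, ?_⟩
    have hℓ' : (ℓ : ℂ) ≠ 0 := Nat.cast_ne_zero.mpr hℓ
    field_simp
    norm_num
  simp only [Nat.cast_add, ← add_assoc, mul_add _ _ (ℓ : ℂ), xi_add _ _ (2 * (ℓ : ℂ)), h, mul_one]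

/-- `Δ₊ = 1` for the Kirby color:
`∑_{s,t=0}^{ℓ-1} {α₁+s}/({α₂+t}{α₁+α₂+s+t}) ξ^{-2(t²+st)} = ℓ{α₁}/({α₂}{α₁+α₂})`. -/
theorem kirby_color_Delta_plus
    (ℓ : ℕ) (hℓ3 : 3 ≤ ℓ) (hodd : Odd ℓ)
    (α₁ α₂ : ℂ)
    (h2 : ∀ m : ℤ, 2 * α₂ ≠ (m : ℂ))
    (h12 : ∀ m : ℤ, 2 * (α₁ + α₂) ≠ (m : ℂ)) :
    ∑ s ∈ Finset.range ℓ, ∑ t ∈ Finset.range ℓ,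
        br ℓ (α₁ + (s : ℂ)) / (br ℓ (α₂ + (t : ℂ)) * br ℓ (α₁ + α₂ + (s : ℂ) + (t : ℂ)))
          * xi ℓ (-2 * ((t : ℂ) ^ 2 + (s : ℂ) * (t : ℂ)))
      = (ℓ : ℂ) * br ℓ α₁ / (br ℓ α₂ * br ℓ (α₁ + α₂)) := by
  have hℓ : ℓ ≠ 0 := hodd.pos.ne'
  have key := (isPrimitiveRoot_xi_neg_two hodd).sum_sum_sub_mul_pow hodd.pos
    (fun t => (xi ℓ (2 * (α₂ + t)) - 1)⁻¹) (fun u => (xi ℓ (2 * (α₁ + α₂ + u)) - 1)⁻¹)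
    ((xi_two_mul_add_periodic hℓ (α₁ + α₂)).comp fun z => (z - 1)⁻¹)
  have frac (s t : ℕ) : br ℓ (α₁ + s) / (br ℓ (α₂ + t) * br ℓ (α₁ + α₂ + s + t)) =
      (xi ℓ (2 * (α₂ + t)) - 1)⁻¹ - (xi ℓ (2 * (α₁ + α₂ + (s + t : ℕ))) - 1)⁻¹ := by
    rw [← br_sub_div ℓ (xi_two_mul_ne_one hℓ h2 t) (xi_two_mul_ne_one hℓ h12 (s + t))]
    push_cast
    congr 2 <;> ring_nf
  have frac_zero := frac 0 0
  simp only [Nat.cast_zero, add_zero] at frac_zero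
  simp only [Nat.cast_zero, add_zero] at key
  rw [mul_div_assoc, frac_zero, ← key]
  refine Finset.sum_congr rfl fun s _ => Finset.sum_congr rfl fun t _ => ?_
  rw [frac, ← xi_mul_natCast]
  push_cast
  ring_nf
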